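/- Let ℓ ≥ 1, n ≥ 0, 0 ≤ p ≤ ℓ+1, and N = n(ℓ+2)+p+1. For the M_ℓ model on the closed chain of N sites with periodic boundary conditions: if 0 ≤ p ≤ ℓ, then dim H_Q^f = 1 for f = nℓ+p and dim H_Q^f = 0 for every other f; if p = ℓ+1, then dim H_Q^f = ℓ+1 for f = (n+1)ℓ and dim H_Q^f = 0 for every other f. Equivalently, the Hamiltonian has exactly one zero-energy ground state, at fermion number nℓ+p, when 0 ≤ p ≤ ℓ, and exactly ℓ+1 zero-energy ground states, at fermion number (n+1)ℓ, when p = ℓ+1. -/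

import Mathlib

attribute [local instance 10] Classical.propDecidable

noncomputable section

/-- A configuration of `N` sites: `true` = occupied, `false` = empty. -/
abbrev Config (N : ℕ) := Fin N → Bool

/-- Extension of a configuration to all of `ℕ`, by empty sites outside the chain. -/
def extc {N : ℕ} (σ : Config N) (t : ℕ) : Bool :=
  if h : t < N then σ ⟨t, h⟩ else false

/-- The fermion number: the number of occupied sites. -/
def fermions {N : ℕ} (σ : Config N) : ℕ :=
  (Finset.univ.filter fun i => σ i = true).card

/-- Allowed configurations of the open chain of `N` sites with exclusion parameter `ℓ`
and special boundary conditions `(c₁, cN)`: no cluster is longer than `ℓ`, the cluster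
containing the first site (if occupied) has length at most `c₁`, and the cluster
containing the last site (if occupied) has length at most `cN`. -/
def OpenOK (N ℓ c₁ cN : ℕ) (σ : Config N) : Prop :=
  (∀ a : ℕ, ¬ ∀ k ≤ ℓ, extc σ (a + k) = true) ∧
  (¬ (c₁ + 1 ≤ N ∧ ∀ k ≤ c₁, extc σ k = true)) ∧
  (¬ (cN + 1 ≤ N ∧ ∀ k ≤ cN, extc σ (N - 1 - k) = true))

/-- Cyclic shift of a site of the closed chain by `k` steps. -/
def cyc {N : ℕ} (i : Fin N) (k : ℕ) : Fin N :=
  ⟨(i.1 + k) % N, Nat.mod_lt _ i.pos⟩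

/-- Allowed configurations of the closed chain of `N` sites with periodic boundary
conditions: the chain is not fully occupied and no maximal cyclic run of occupied
sites is longer than `ℓ`. -/
def PerOK (N ℓ : ℕ) (σ : Config N) : Prop :=
  ∀ i : Fin N, ∃ k ≤ ℓ, σ (cyc i k) = false

/-- The fermionic sign `(-1)^{#{j < i : σ j = 1}}`. -/
def sgn {N : ℕ} (σ : Config N) (i : Fin N) : ℂ :=
  (-1 : ℂ) ^ ((Finset.univ.filter fun j => j < i ∧ σ j = true).card)

/-- The Hilbert space `V_N`: complex functions on allowed configurations. -/
abbrev AState (N : ℕ) (OK : Config N → Prop) := {σ : Config N // OK σ} → ℂ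

/-- Matrix of the supercharge with amplitudes `A`, with particle insertion
restricted to the sublattice `S`: the entry `(τ, σ)` is the amplitude (with fermionic
sign) for obtaining `τ` from `σ` by occupying an empty site of `S`. -/
def QmatA (N : ℕ) (OK : Config N → Prop) (S : Fin N → Prop)
    (A : Config N → Fin N → ℂ) :
    Matrix {σ : Config N // OK σ} {σ : Config N // OK σ} ℂ := fun τ σ =>
  ∑ i : Fin N,
    if S i ∧ σ.1 i = false ∧ τ.1 = Function.update σ.1 i true
    then A σ.1 i * sgn σ.1 i else 0

/-- The supercharge with amplitudes `A` restricted to the sublattice `S`, as a linear map. -/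
def QopA (N : ℕ) (OK : Config N → Prop) (S : Fin N → Prop)
    (A : Config N → Fin N → ℂ) : AState N OK →ₗ[ℂ] AState N OK :=
  (QmatA N OK S A).mulVecLin

/-- The unit-coupling supercharge restricted to the sublattice `S`. -/
def Qop (N : ℕ) (OK : Config N → Prop) (S : Fin N → Prop) :
    AState N OK →ₗ[ℂ] AState N OK :=
  QopA N OK S fun _ _ => 1

/-- The subspace `V_{N,f}` of states supported on configurations with fermion number `f`. -/
def gradeV (N : ℕ) (OK : Config N → Prop) (f : ℕ) :
    Submodule ℂ (AState N OK) where
  carrier := {ψ | ∀ σ, fermions σ.1 ≠ f → ψ σ = 0}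
  add_mem' := by
    intro a b ha hb σ h
    show a σ + b σ = 0
    rw [ha σ h, hb σ h, add_zero]
  zero_mem' := by intro σ h; rfl
  smul_mem' := by
    intro c a ha σ h
    show c * a σ = 0
    rw [ha σ h, mul_zero]

/-- The cocycles at gradeV `f`: `ker Q ∩ V_{N,f}` (for the supercharge restricted to `S`). -/
def cocycles (N : ℕ) (OK : Config N → Prop) (S : Fin N → Prop) (f : ℕ) :
    Submodule ℂ (AState N OK) :=
  LinearMap.ker (Qop N OK S) ⊓ gradeV N OK f

/-- The coboundaries at gradeV `f`: `Q (V_{N,f-1})` (for the supercharge restricted to `S`). -/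
def cobounds (N : ℕ) (OK : Config N → Prop) (S : Fin N → Prop) (f : ℕ) :
    Submodule ℂ (AState N OK) :=
  (gradeV N OK (f - 1)).map (Qop N OK S)

/-- The cohomology `H_Q^f = ker (Q : V_{N,f} → V_{N,f+1}) / Q (V_{N,f-1})`. -/
abbrev CohSpace (N : ℕ) (OK : Config N → Prop) (S : Fin N → Prop) (f : ℕ) :=
  cocycles N OK S f ⧸ ((cobounds N OK S f).comap (cocycles N OK S f).subtype)

/-- The dimension of `H_Q^f`. -/
def cohDim (N : ℕ) (OK : Config N → Prop) (S : Fin N → Prop) (f : ℕ) : ℕ :=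
  Module.finrank ℂ (CohSpace N OK S f)

/-- The cohomology class represented by a cocycle. -/
def cohClass (N : ℕ) (OK : Config N → Prop) (S : Fin N → Prop) (f : ℕ)
    (ψ : AState N OK) (h : ψ ∈ cocycles N OK S f) : CohSpace N OK S f :=
  Submodule.Quotient.mk ⟨ψ, h⟩

/-- Extension of a state by zero to all configurations. -/
def extState {N : ℕ} {OK : Config N → Prop} (ψ : AState N OK) (σ : Config N) : ℂ :=
  if h : OK σ then ψ ⟨σ, h⟩ else 0

/-- The supercharge on functions of all configurations, written through particle removal. -/
def fullQ {N : ℕ} (φ : Config N → ℂ) (τ : Config N) : ℂ :=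
  ∑ i : Fin N, if τ i = true then sgn τ i * φ (Function.update τ i false) else 0

section Supercharge

variable {N : ℕ} {OK : Config N → Prop}

lemma extState_coe (ψ : AState N OK) (σ : {σ : Config N // OK σ}) :
    extState ψ σ.1 = ψ σ := by
  simp [extState, σ.2]

lemma sgn_ne_zero (σ : Config N) (i : Fin N) : sgn σ i ≠ 0 := by
  simp [sgn]

lemma sgn_mul_self (σ : Config N) (i : Fin N) : sgn σ i * sgn σ i = 1 := by
  rw [sgn, ← pow_add, ← two_mul, pow_mul]; simp

lemma sgn_update_of_le (σ : Config N) {i j : Fin N} (h : j ≤ i) (x : Bool) :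
    sgn (Function.update σ i x) j = sgn σ j := by
  unfold sgn
  congr 2
  ext k
  simp only [Finset.mem_filter, Finset.mem_univ, true_and]
  constructor <;> rintro ⟨h1, h2⟩ <;>
    simpa [h1, Function.update_of_ne (h1.trans_le h).ne] using h2

lemma sgn_update_of_lt (σ : Config N) {i j : Fin N} (h : i < j) (hi : σ i = true) :
    sgn (Function.update σ i false) j = -sgn σ j := by
  unfold sgn
  have : (Finset.univ.filter fun k => k < j ∧ σ k = true) =
      insert i (Finset.univ.filter fun k => k < j ∧ Function.update σ i false k = true) := by
    ext k
    by_cases hk : k = i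
    · subst hk; simp [h, hi]
    · simp [hk]
  rw [this, Finset.card_insert_of_notMem (by simp), pow_succ]
  ring

lemma fermions_update_false (τ : Config N) {i : Fin N} (hi : τ i = true) :
    fermions (Function.update τ i false) + 1 = fermions τ := by
  unfold fermions
  have : (Finset.univ.filter fun k => τ k = true) =
      insert i (Finset.univ.filter fun k => Function.update τ i false k = true) := by
    ext k
    by_cases hk : k = i
    · subst hk; simp [hi]
    · simp [hk]
  rw [this, Finset.card_insert_of_notMem (by simp)]

lemma fermions_update_true (σ : Config N) {i : Fin N} (hi : σ i = false) :
    fermions (Function.update σ i true) = fermions σ + 1 := by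
  rw [← fermions_update_false (Function.update σ i true) (i := i) (by simp)]
  simp [← hi]

variable (hdown : ∀ σ i, OK σ → OK (Function.update σ i false))

include hdown in
lemma Qop_apply (ψ : AState N OK) (τ : {σ : Config N // OK σ}) :
    Qop N OK (fun _ => True) ψ τ = fullQ (extState ψ) τ.1 := by
  have h1 : Qop N OK (fun _ => True) ψ τ =
      ∑ σ : {σ : Config N // OK σ}, (∑ i : Fin N,
        if True ∧ σ.1 i = false ∧ τ.1 = Function.update σ.1 i true
        then 1 * sgn σ.1 i else 0) * ψ σ := by
    simp only [Qop, QopA, Matrix.mulVecLin_apply, Matrix.mulVec, dotProduct, QmatA]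
  rw [h1]
  simp only [Finset.sum_mul]
  rw [Finset.sum_comm, fullQ]
  refine Finset.sum_congr rfl fun i _ => ?_
  by_cases hi : τ.1 i = true
  · rw [if_pos hi, Finset.sum_eq_single ⟨Function.update τ.1 i false, hdown _ i τ.2⟩]
    · rw [if_pos (by simp [← hi]), sgn_update_of_le _ le_rfl, one_mul,
        ← extState_coe ψ]
    · rintro ⟨σ, hσ⟩ _ hne
      rw [if_neg, zero_mul]
      rintro ⟨-, h2, h3⟩
      apply hne
      ext1
      simp only at h2 h3 ⊢
      rw [h3, Function.update_idem, ← h2, Function.update_eq_self]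
    · simp
  · rw [if_neg hi]
    refine Finset.sum_eq_zero fun σ _ => ?_
    rw [if_neg, zero_mul]
    rintro ⟨-, -, h3⟩
    apply hi
    rw [h3]; simp

lemma fullQ_fullQ (φ : Config N → ℂ) (τ : Config N) : fullQ (fullQ φ) τ = 0 := by
  have key : fullQ (fullQ φ) τ = ∑ i : Fin N, ∑ j : Fin N,
      if i ≠ j ∧ τ i = true ∧ τ j = true then
        sgn τ i * sgn (Function.update τ i false) j *
          φ (Function.update (Function.update τ i false) j false) else 0 := by
    unfold fullQ
    refine Finset.sum_congr rfl fun i _ => ?_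
    by_cases hi : τ i = true
    · rw [if_pos hi, Finset.mul_sum]
      refine Finset.sum_congr rfl fun j _ => ?_
      by_cases hij : i = j
      · subst hij; simp
      · rw [Function.update_of_ne (Ne.symm hij)]
        by_cases hj : τ j = true
        · rw [if_pos hj, if_pos ⟨hij, hi, hj⟩, mul_assoc]
        · rw [if_neg hj, if_neg (by tauto), mul_zero]
    · rw [if_neg hi]
      exact (Finset.sum_eq_zero fun j _ => if_neg (by tauto)).symm
  have anti : fullQ (fullQ φ) τ = -fullQ (fullQ φ) τ := by
    conv_rhs => rw [key, Finset.sum_comm]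
    rw [key, ← Finset.sum_neg_distrib]
    refine Finset.sum_congr rfl fun i _ => ?_
    rw [← Finset.sum_neg_distrib]
    refine Finset.sum_congr rfl fun j _ => ?_
    by_cases h : i ≠ j ∧ τ i = true ∧ τ j = true
    · obtain ⟨hij, hi, hj⟩ := h
      rw [if_pos ⟨hij, hi, hj⟩, if_pos ⟨hij.symm, hj, hi⟩, Function.update_comm hij]
      rcases lt_or_gt_of_ne hij with h | h
      · rw [sgn_update_of_lt _ h hi, sgn_update_of_le _ h.le]; ring
      · rw [sgn_update_of_lt _ h hj, sgn_update_of_le _ h.le]; ring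
    · rw [if_neg h, if_neg (by tauto), neg_zero]
  exact self_eq_neg.mp anti

include hdown in
lemma Qop_Qop (ψ : AState N OK) :
    Qop N OK (fun _ => True) (Qop N OK (fun _ => True) ψ) = 0 := by
  ext τ
  rw [Qop_apply hdown, Pi.zero_apply, ← fullQ_fullQ (extState ψ) τ.1, fullQ, fullQ]
  refine Finset.sum_congr rfl fun i _ => ?_
  rw [extState, dif_pos (hdown _ i τ.2), Qop_apply hdown]

include hdown in
lemma Qop_eq_zero_of_removals (ψ : AState N OK) (τ : {σ : Config N // OK σ})
    (h : ∀ i, τ.1 i = true → ψ ⟨Function.update τ.1 i false, hdown _ i τ.2⟩ = 0) :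
    Qop N OK (fun _ => True) ψ τ = 0 := by
  rw [Qop_apply hdown, fullQ]
  refine Finset.sum_eq_zero fun i _ => ?_
  split_ifs with hi
  · rw [extState, dif_pos (hdown _ i τ.2), h i hi, mul_zero]
  · rfl

include hdown in
lemma Qop_eq_single (ψ : AState N OK) (τ : {σ : Config N // OK σ}) (v : Fin N)
    (hv : τ.1 v = true)
    (h : ∀ i, i ≠ v → τ.1 i = true →
      ψ ⟨Function.update τ.1 i false, hdown _ i τ.2⟩ = 0) :
    Qop N OK (fun _ => True) ψ τ =
      sgn τ.1 v * ψ ⟨Function.update τ.1 v false, hdown _ v τ.2⟩ := by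
  rw [Qop_apply hdown, fullQ, Finset.sum_eq_single v]
  · rw [if_pos hv, extState, dif_pos (hdown _ v τ.2)]
  · intro i _ hi
    split_ifs with hτ
    · rw [extState, dif_pos (hdown _ i τ.2), h i hi hτ, mul_zero]
    · rfl
  · simp

/-- States supported on configurations with fermion number `f - 1`; zero when `f = 0`. -/
def predGradeV (N : ℕ) (OK : Config N → Prop) (f : ℕ) : Submodule ℂ (AState N OK) where
  carrier := {ψ | ∀ σ, fermions σ.1 + 1 ≠ f → ψ σ = 0}
  add_mem' := by
    intro a b ha hb σ h
    rw [Pi.add_apply, ha σ h, hb σ h, add_zero]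
  zero_mem' := by intro σ h; rfl
  smul_mem' := by
    intro c a ha σ h
    rw [Pi.smul_apply, ha σ h, smul_zero]

lemma predGradeV_le (f : ℕ) : predGradeV N OK f ≤ gradeV N OK (f - 1) := fun _ hψ σ h =>
  hψ σ (by omega)

lemma predGradeV_succ (f : ℕ) : gradeV N OK f ≤ predGradeV N OK (f + 1) := fun _ hψ σ h =>
  hψ σ (by omega)

include hdown in
lemma Qop_mem_gradeV {f : ℕ} {ψ : AState N OK} (hψ : ψ ∈ predGradeV N OK f) :
    Qop N OK (fun _ => True) ψ ∈ gradeV N OK f := by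
  intro τ hτ
  refine Qop_eq_zero_of_removals hdown _ _ fun i hi => hψ _ fun h => hτ ?_
  rw [← fermions_update_false _ hi, h]

end Supercharge

/-- States supported on configurations of stage at least `k`. -/
def stageV {N : ℕ} (OK : Config N → Prop) (r : Config N → ℕ) (k : ℕ) :
    Submodule ℂ (AState N OK) where
  carrier := {ψ | ∀ σ, r σ.1 < k → ψ σ = 0}
  add_mem' := by
    intro a b ha hb σ h
    rw [Pi.add_apply, ha σ h, hb σ h, add_zero]
  zero_mem' := by intro σ h; rfl
  smul_mem' := by
    intro c a ha σ h
    rw [Pi.smul_apply, ha σ h, smul_zero]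

/-- An acyclic matching of the allowed configurations, organised in stages: the stage `r` does
not decrease when particles are added, and each stage is either critical, with all its
configurations of fermion number `f₀`, or is invariant under toggling the site `v`. -/
structure StagedMatching {N : ℕ} (OK : Config N → Prop) (r : Config N → ℕ) (v : ℕ → Fin N)
    (crit : ℕ → Prop) (f₀ : ℕ) : Prop where
  down : ∀ σ i, OK σ → OK (Function.update σ i false)
  mono : ∀ σ i, OK σ → r (Function.update σ i false) ≤ r σ
  toggle_ok : ∀ σ, OK σ → ¬ crit (r σ) → OK (Function.update σ (v (r σ)) true)
  toggle_stage : ∀ σ x, OK σ → ¬ crit (r σ) → r (Function.update σ (v (r σ)) x) = r σ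
  fermions_crit : ∀ σ, OK σ → crit (r σ) → fermions σ = f₀

namespace StagedMatching

variable {N : ℕ} {OK : Config N → Prop} {r : Config N → ℕ} {v : ℕ → Fin N}
  {crit : ℕ → Prop} {f₀ : ℕ}

lemma Qop_mem_stageV (M : StagedMatching OK r v crit f₀) {k : ℕ} {ψ : AState N OK}
    (hψ : ψ ∈ stageV OK r k) : Qop N OK (fun _ => True) ψ ∈ stageV OK r k := fun τ hτ =>
  Qop_eq_zero_of_removals M.down _ _ fun i _ => hψ _ ((M.mono _ i τ.2).trans_lt hτ)

/-- At a non-critical stage a state can be pushed to later stages by adding a coboundary. -/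
lemma exists_sub_mem_stageV_succ (M : StagedMatching OK r v crit f₀) {k f : ℕ}
    (hk : ¬ crit k) {χ : AState N OK} (hf : χ ∈ gradeV N OK f) (hs : χ ∈ stageV OK r k)
    (hQ : Qop N OK (fun _ => True) χ ∈ stageV OK r (k + 1)) :
    ∃ η ∈ predGradeV N OK f, η ∈ stageV OK r k ∧
      χ - Qop N OK (fun _ => True) η ∈ stageV OK r (k + 1) := by
  set η : AState N OK := fun σ => if r σ.1 = k ∧ σ.1 (v k) = false then
    sgn σ.1 (v k) * extState χ (Function.update σ.1 (v k) true) else 0 with hη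
  have hηs : η ∈ stageV OK r k := fun σ h => if_neg fun h' => by omega
  have hηf : η ∈ predGradeV N OK f := by
    intro σ h
    simp only [hη]
    split_ifs with h'
    · rw [extState]
      split_ifs with h2
      · rw [hf _ (by simp only [fermions_update_true _ h'.2]; omega), mul_zero]
      · simp
    · rfl
  refine ⟨η, hηf, hηs, ?_⟩
  set χ' := χ - Qop N OK (fun _ => True) η with hχ'
  have hs' : χ' ∈ stageV OK r k := Submodule.sub_mem _ hs (M.Qop_mem_stageV hηs)
  have hQ' : Qop N OK (fun _ => True) χ' = Qop N OK (fun _ => True) χ := by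
    rw [hχ', map_sub, Qop_Qop M.down, sub_zero]
  have hocc : ∀ τ : {σ : Config N // OK σ}, r τ.1 ≤ k → τ.1 (v k) = true → χ' τ = 0 := by
    intro τ hτ hv
    rcases hτ.lt_or_eq with h | h
    · exact hs' _ h
    subst h
    have hr := M.toggle_stage _ false τ.2 hk
    rw [hχ', Pi.sub_apply, Qop_eq_single M.down η τ _ hv]
    · simp only [hη, hr, Function.update_self, and_self, if_true, sgn_update_of_le _ le_rfl,
        Function.update_idem]
      rw [← hv, Function.update_eq_self, extState_coe, ← mul_assoc, sgn_mul_self, one_mul,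
        sub_self]
    · intro i hi _
      simp only [hη]
      rw [if_neg]
      rintro ⟨-, h2⟩
      rw [Function.update_of_ne hi.symm, hv] at h2
      cases h2
  intro τ hτ
  by_cases hv : τ.1 (v k) = true
  · exact hocc τ (by omega) hv
  rcases (Nat.lt_succ_iff.mp hτ).lt_or_eq with h | h
  · exact hs' _ h
  have hv' : τ.1 (v k) = false := by simpa using hv
  subst h
  have hOK := M.toggle_ok _ τ.2 hk
  have hr := M.toggle_stage _ true τ.2 hk
  have h0 : Qop N OK (fun _ => True) χ' ⟨_, hOK⟩ = 0 := by
    rw [hQ']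
    exact hQ _ (by simp only [hr]; omega)
  rw [Qop_eq_single M.down χ' ⟨_, hOK⟩ (v (r τ.1)) (by simp)] at h0
  · have h1 := (mul_eq_zero.mp h0).resolve_left (sgn_ne_zero _ _)
    have h2 : (⟨Function.update (Function.update τ.1 (v (r τ.1)) true) (v (r τ.1)) false,
        M.down _ _ hOK⟩ : {σ : Config N // OK σ}) = τ := by
      ext1
      simp [← hv']
    rwa [h2] at h1
  · intro i hi _
    apply hocc
    · exact (M.mono _ i hOK).trans hr.le
    · simp [hi.symm]

/-- Away from the critical fermion number, states can be pushed through all stages. -/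
lemma exists_sub_mem_stageV_add (M : StagedMatching OK r v crit f₀) {f : ℕ} (hf₀ : f ≠ f₀)
    (d k : ℕ) (χ : AState N OK) (hf : χ ∈ gradeV N OK f) (hs : χ ∈ stageV OK r k)
    (hQ : Qop N OK (fun _ => True) χ ∈ stageV OK r (k + d)) :
    ∃ η ∈ predGradeV N OK f, η ∈ stageV OK r k ∧
      χ - Qop N OK (fun _ => True) η ∈ stageV OK r (k + d) := by
  induction d with
  | zero => exact ⟨0, Submodule.zero_mem _, Submodule.zero_mem _, by simpa using hs⟩
  | succ d ih =>
    obtain ⟨η, h1, h2, h3⟩ := ih fun σ h => hQ σ (by omega)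
    set χ' := χ - Qop N OK (fun _ => True) η with hχ'
    have hQη := Qop_mem_gradeV M.down h1
    have hf' : χ' ∈ gradeV N OK f := Submodule.sub_mem _ hf hQη
    by_cases hk : crit (k + d)
    · refine ⟨η, h1, h2, fun σ hσ => ?_⟩
      by_cases hr : r σ.1 = k + d
      · refine hf' σ fun hfe => hf₀ ?_
        rw [← hfe, M.fermions_crit _ σ.2 (hr ▸ hk)]
      · exact h3 σ (by omega)
    · have hQ' : Qop N OK (fun _ => True) χ' ∈ stageV OK r (k + d + 1) := by
        rw [hχ', map_sub, Qop_Qop M.down, sub_zero]; exact hQ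
      obtain ⟨η', g1, g2, g3⟩ := M.exists_sub_mem_stageV_succ hk hf' h3 hQ'
      refine ⟨η + η', Submodule.add_mem _ h1 g1,
        Submodule.add_mem _ h2 fun σ hσ => g2 σ (by omega), ?_⟩
      rw [map_add, ← sub_sub]
      exact g3


/-- Off the critical fermion number, a cocycle supported on late stages is the coboundary of a
state supported on late stages. -/
lemma exists_eq_Qop (M : StagedMatching OK r v crit f₀) {f k : ℕ} (hf₀ : f ≠ f₀)
    {χ : AState N OK} (hf : χ ∈ gradeV N OK f) (hs : χ ∈ stageV OK r k)
    (hQ : Qop N OK (fun _ => True) χ = 0) :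
    ∃ η ∈ predGradeV N OK f, η ∈ stageV OK r k ∧ χ = Qop N OK (fun _ => True) η := by
  set d := (Finset.univ.sup r) + 1 with hd
  have hr : ∀ σ, r σ < k + d := fun σ => by
    have := Finset.le_sup (f := r) (Finset.mem_univ σ)
    omega
  obtain ⟨η, h1, h2, h3⟩ := M.exists_sub_mem_stageV_add hf₀ d k χ hf hs
    (by rw [hQ]; exact Submodule.zero_mem _)
  exact ⟨η, h1, h2, sub_eq_zero.mp (funext fun σ => h3 σ (hr _))⟩

lemma cohDim_of_ne (M : StagedMatching OK r v crit f₀) {f : ℕ} (hf₀ : f ≠ f₀) :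
    cohDim N OK (fun _ => True) f = 0 := by
  have : Subsingleton (CohSpace N OK (fun _ => True) f) := by
    rw [Submodule.Quotient.subsingleton_iff, eq_top_iff]
    rintro ⟨χ, hχ⟩ -
    obtain ⟨η, h1, -, h3⟩ := M.exists_eq_Qop (k := 0) hf₀ hχ.2 (fun σ h => by omega) hχ.1
    exact ⟨η, predGradeV_le f h1, h3.symm⟩
  exact Module.finrank_zero_of_subsingleton

/-- Each critical configuration starts a cocycle, with all its other terms at later stages. -/
lemma exists_cocycle (M : StagedMatching OK r v crit f₀) (c : {σ : Config N // OK σ})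
    (hc : crit (r c.1)) : ∃ w ∈ cocycles N OK (fun _ => True) f₀,
      ∀ σ, r σ.1 ≤ r c.1 → w σ = if σ = c then 1 else 0 := by
  have hcf := M.fermions_crit _ c.2 hc
  set e : AState N OK := Pi.single c 1 with he
  have he0 : ∀ σ, σ ≠ c → e σ = 0 := fun σ h => Pi.single_eq_of_ne h _
  have hef : e ∈ gradeV N OK f₀ := fun σ h => he0 σ fun h' => h (h' ▸ hcf)
  have hes : e ∈ stageV OK r (r c.1) := fun σ h => he0 σ fun h' => by
    rw [h'] at h; exact lt_irrefl _ h
  have hQf := Qop_mem_gradeV M.down (predGradeV_succ _ hef)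
  have hQs : Qop N OK (fun _ => True) e ∈ stageV OK r (r c.1 + 1) := by
    intro σ hσ
    rcases (Nat.lt_succ_iff.mp hσ).lt_or_eq with h | h
    · exact M.Qop_mem_stageV hes _ h
    · refine hQf σ ?_
      rw [M.fermions_crit _ σ.2 (h ▸ hc)]
      omega
  obtain ⟨η, h1, h2, h3⟩ := M.exists_eq_Qop (by omega) hQf hQs (Qop_Qop M.down e)
  refine ⟨e - η, ⟨?_, Submodule.sub_mem _ hef fun σ h => h1 σ (by omega)⟩, fun σ hσ => ?_⟩
  · rw [SetLike.mem_coe, LinearMap.mem_ker, map_sub, h3, sub_self]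
  · rw [Pi.sub_apply, h2 σ (by omega), sub_zero, he, Pi.single_apply]

/-- The cohomology of a complex with a staged matching is concentrated at the critical fermion
number, with dimension the number of critical configurations. -/
theorem cohDim_eq (M : StagedMatching OK r v crit f₀) (f : ℕ) :
    cohDim N OK (fun _ => True) f =
      if f = f₀ then Nat.card {σ : Config N // OK σ ∧ crit (r σ)} else 0 := by
  split_ifs with hf
  swap
  · exact M.cohDim_of_ne hf
  subst hf
  have hw : ∀ c : {σ : Config N // OK σ ∧ crit (r σ)},
      ∃ w ∈ cocycles N OK (fun _ => True) f,
      ∀ σ, r σ.1 ≤ r c.1 → w σ = if σ = ⟨c.1, c.2.1⟩ then 1 else 0 :=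
    fun c => M.exists_cocycle ⟨c.1, c.2.1⟩ c.2.2
  choose w hwZ hwr using hw
  let g : ({σ : Config N // OK σ ∧ crit (r σ)} → ℂ) →ₗ[ℂ]
      CohSpace N OK (fun _ => True) f :=
    (Submodule.mkQ _) ∘ₗ Fintype.linearCombination ℂ
      (fun c => (⟨w c, hwZ c⟩ : cocycles N OK (fun _ => True) f))
  have hinj : Function.Injective g := by
    rw [← LinearMap.ker_eq_bot, LinearMap.ker_eq_bot']
    intro a ha
    have hmem := (Submodule.Quotient.mk_eq_zero _).mp ha
    obtain ⟨χ₀, hχ₀, hQ₀⟩ := hmem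
    have hQ₀' : Qop N OK (fun _ => True) χ₀ = ∑ c, a c • w c := by
      rw [hQ₀]; simp [Fintype.linearCombination_apply]
    obtain ⟨q, hq, χ, hχ, hQ⟩ : ∃ q, q ≠ f ∧ ∃ χ ∈ gradeV N OK q,
        Qop N OK (fun _ => True) χ = ∑ c, a c • w c := by
      rcases Nat.eq_zero_or_pos f with h0 | hpos
      · subst h0
        refine ⟨1, one_ne_zero, 0, Submodule.zero_mem _, ?_⟩
        rw [map_zero]
        have h1 : Qop N OK (fun _ => True) χ₀ ∈ gradeV N OK 1 :=
          Qop_mem_gradeV M.down (predGradeV_succ _ hχ₀)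
        have h2 : Qop N OK (fun _ => True) χ₀ ∈ gradeV N OK 0 := by
          rw [hQ₀']
          exact Submodule.sum_mem _ fun c _ => Submodule.smul_mem _ _ (hwZ c).2
        rw [← hQ₀']
        funext σ
        by_cases h : fermions σ.1 = 0
        · exact (h1 σ (by omega)).symm
        · exact (h2 σ h).symm
      · exact ⟨f - 1, by omega, χ₀, hχ₀, hQ₀'⟩
    have hzero : ∀ k c, r c.1 = k → a c = 0 := by
      intro k
      induction k using Nat.strong_induction_on with
      | _ k ih =>
        intro c hc
        have heval : ∀ σ : {σ : Config N // OK σ}, r σ.1 ≤ k → (∑ c, a c • w c) σ =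
            ∑ c' : {σ : Config N // OK σ ∧ crit (r σ)},
              if σ = ⟨c'.1, c'.2.1⟩ then a c' else 0 := by
          intro σ hσ
          rw [Finset.sum_apply]
          refine Finset.sum_congr rfl fun c' _ => ?_
          rcases lt_or_ge (r c'.1) k with h | h
          · simp [ih _ h c' rfl]
          · simp [hwr c' σ (hσ.trans h)]
        have hsupp : Qop N OK (fun _ => True) χ ∈ stageV OK r (0 + k) := by
          intro σ hσ
          rw [hQ, heval σ (by omega)]
          refine Finset.sum_eq_zero fun c' _ => ?_
          split_ifs with h
          · exact ih (r c'.1) (by rw [h] at hσ; simpa using hσ) c' rfl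
          · rfl
        obtain ⟨η, -, -, h3⟩ := M.exists_sub_mem_stageV_add hq k 0 χ hχ
          (fun σ h => by omega) hsupp
        set χ' := χ - Qop N OK (fun _ => True) η with hχ'
        have hQ' : Qop N OK (fun _ => True) χ' = ∑ c, a c • w c := by
          rw [hχ', map_sub, Qop_Qop M.down, sub_zero, hQ]
        have h0 : Qop N OK (fun _ => True) χ' ⟨c.1, c.2.1⟩ = 0 := by
          refine Qop_eq_zero_of_removals M.down _ _ fun i hi => h3 _ ?_
          rw [zero_add, ← hc]
          refine lt_of_le_of_ne (M.mono _ i c.2.1) fun h => ?_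
          have h4 := M.fermions_crit _ (M.down _ i c.2.1) (h ▸ c.2.2)
          have h5 := M.fermions_crit _ c.2.1 c.2.2
          have h6 := fermions_update_false _ hi
          simp only at h6
          omega
        rw [hQ', heval _ hc.le, Finset.sum_eq_single c] at h0
        · simpa using h0
        · intro c' _ hne
          rw [if_neg]
          intro h
          exact hne (Subtype.ext (congrArg Subtype.val h).symm)
        · simp
    funext c
    exact hzero _ c rfl
  have hsurj : Function.Surjective g := by
    have key : ∀ d k, ∀ χ ∈ cocycles N OK (fun _ => True) f, χ ∈ stageV OK r k →
        Finset.univ.sup r < k + d → ∃ a : {σ : Config N // OK σ ∧ crit (r σ)} → ℂ,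
          ∃ η ∈ gradeV N OK (f - 1), χ = ∑ c, a c • w c + Qop N OK (fun _ => True) η := by
      intro d
      induction d with
      | zero =>
        intro k χ _ hs hk
        refine ⟨0, 0, Submodule.zero_mem _, ?_⟩
        funext σ
        rw [hs σ ((Finset.le_sup (f := r) (Finset.mem_univ σ.1)).trans_lt hk)]
        simp
      | succ d ih =>
        intro k χ hχ hs hk
        by_cases hc : crit k
        · let b : {σ : Config N // OK σ ∧ crit (r σ)} → ℂ :=
            fun c => if r c.1 = k then χ ⟨c.1, c.2.1⟩ else 0
          obtain ⟨a, η, hη, h⟩ := ih (k + 1) (χ - ∑ c, b c • w c)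
            (Submodule.sub_mem _ hχ
              (Submodule.sum_mem _ fun c _ => Submodule.smul_mem _ _ (hwZ c)))
            (fun σ hσ => by
              have hterm : ∀ c : {σ : Config N // OK σ ∧ crit (r σ)}, (b c • w c) σ =
                  if σ = ⟨c.1, c.2.1⟩ then b c else 0 := by
                intro c
                by_cases h : r c.1 = k
                · simp [hwr c σ (by omega)]
                · simp [b, h]
              rw [Pi.sub_apply, Finset.sum_apply, Finset.sum_congr rfl fun c _ => hterm c]
              rcases (Nat.lt_succ_iff.mp hσ).lt_or_eq with h | h
              · rw [hs σ h, zero_sub, neg_eq_zero]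
                refine Finset.sum_eq_zero fun c _ => ?_
                split_ifs with h'
                · subst h'; exact if_neg h.ne
                · rfl
              · rw [Finset.sum_eq_single ⟨σ.1, σ.2, h ▸ hc⟩]
                · simp [b, h]
                · rintro c - hne
                  rw [if_neg]
                  rintro rfl
                  exact hne rfl
                · simp)
            (by omega)
          refine ⟨a + b, η, hη, ?_⟩
          rw [sub_eq_iff_eq_add] at h
          rw [h]
          simp only [Pi.add_apply, add_smul, Finset.sum_add_distrib]
          abel
        · obtain ⟨η, h1, -, h3⟩ := M.exists_sub_mem_stageV_succ hc hχ.2 hs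
            (by rw [LinearMap.mem_ker.mp hχ.1]; exact Submodule.zero_mem _)
          obtain ⟨a, η', hη', h⟩ := ih (k + 1) _
            ⟨by rw [SetLike.mem_coe, LinearMap.mem_ker, map_sub, Qop_Qop M.down, sub_zero]; exact hχ.1,
              Submodule.sub_mem _ hχ.2 (Qop_mem_gradeV M.down h1)⟩ h3 (by omega)
          refine ⟨a, η' + η, Submodule.add_mem _ hη' (predGradeV_le f h1), ?_⟩
          rw [sub_eq_iff_eq_add] at h
          rw [h, map_add, add_assoc]
    intro x
    obtain ⟨⟨χ, hχ⟩, rfl⟩ := Submodule.mkQ_surjective _ x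
    obtain ⟨a, η, hη, h⟩ := key (Finset.univ.sup r + 1) 0 χ hχ (fun σ h => by omega) (by omega)
    refine ⟨a, (Submodule.Quotient.eq _).mpr ⟨-η, Submodule.neg_mem _ hη, ?_⟩⟩
    rw [map_neg]
    simp [Fintype.linearCombination_apply, h]
  rw [cohDim, ← (LinearEquiv.ofBijective g ⟨hinj, hsurj⟩).finrank_eq,
    Module.finrank_fintype_fun_eq_card, Nat.card_eq_fintype_card]

end StagedMatching
/-- Occupation of the site `t mod N` of the closed chain. -/
def occ {N : ℕ} (σ : Config N) (t : ℤ) : Prop :=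
  ∃ i : Fin N, (i.1 : ℤ) = t % N ∧ σ i = true

section Occupation

variable {N ℓ : ℕ} {σ : Config N}

lemma occ_coe (i : Fin N) : occ σ (i.1 : ℤ) ↔ σ i = true := by
  have h : ((i.1 : ℕ) : ℤ) % N = i.1 :=
    Int.emod_eq_of_lt (by positivity) (by exact_mod_cast i.2)
  constructor
  · rintro ⟨j, hj, hσ⟩
    rw [h] at hj
    rwa [← Fin.ext (by exact_mod_cast hj : j.1 = i.1)]
  · exact fun hσ => ⟨i, h.symm, hσ⟩

lemma occ_congr {s t : ℤ} (h : s % N = t % N) : occ σ s ↔ occ σ t := by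
  unfold occ
  rw [h]

lemma occ_add_mul (t q : ℤ) : occ σ (t + N * q) ↔ occ σ t :=
  occ_congr (Int.add_mul_emod_self_left _ _ _)

lemma occ_add_period (t : ℤ) : occ σ (t + N) ↔ occ σ t := by
  simpa using occ_add_mul (σ := σ) t 1

lemma occ_of_emod {t : ℤ} {i : Fin N} (h : t % N = i.1) : occ σ t ↔ σ i = true := by
  rw [← occ_coe]
  refine occ_congr ?_
  rw [h, Int.emod_eq_of_lt (by positivity) (by exact_mod_cast i.2)]

lemma occ_update_of_ne {t : ℤ} {i : Fin N} (h : t % N ≠ i.1) (x : Bool) :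
    occ (Function.update σ i x) t ↔ occ σ t := by
  unfold occ
  refine exists_congr fun j => and_congr_right fun hj => ?_
  rw [Function.update_of_ne]
  rintro rfl
  exact h hj.symm

lemma occ_update_true {t : ℤ} {i : Fin N} :
    occ (Function.update σ i true) t ↔ occ σ t ∨ t % N = i.1 := by
  by_cases h : t % N = i.1
  · simp [occ_of_emod h, h]
  · simp [occ_update_of_ne h, h]

lemma occ_of_update_false {t : ℤ} {i : Fin N} (h : occ (Function.update σ i false) t) :
    occ σ t := by
  by_cases ht : t % N = i.1
  · simp [occ_of_emod ht] at h
  · rwa [occ_update_of_ne ht] at h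

lemma emod_ne_of_near {t : ℤ} {i : Fin N} (h : t ≠ i.1) (h1 : (i.1 : ℤ) - N < t)
    (h2 : t < i.1 + N) : t % N ≠ i.1 := by
  intro h3
  have hd : (N : ℤ) ∣ t - i.1 := h3 ▸ Int.dvd_self_sub_emod
  exact h (sub_eq_zero.mp (Int.eq_zero_of_abs_lt_dvd hd (by rw [abs_lt]; omega)))

lemma ext_occ {τ : Config N} (h : ∀ t : ℕ, t < N → (occ σ t ↔ occ τ t)) : σ = τ := by
  funext i
  have := h i.1 i.2
  rw [occ_coe, occ_coe] at this
  exact Bool.eq_iff_iff.mpr this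

lemma perOK_iff (hN : 0 < N) :
    PerOK N ℓ σ ↔ ∀ s : ℤ, ∃ k : ℕ, k ≤ ℓ ∧ ¬ occ σ (s + k) := by
  have hcyc : ∀ (i : Fin N) (k : ℕ), occ σ (i.1 + k) ↔ σ (cyc i k) = true := fun i k =>
    occ_of_emod (by simp [cyc])
  constructor
  · intro h s
    have h0 := Int.emod_nonneg s (b := N) (by omega)
    have h1 := Int.emod_lt_of_pos s (b := N) (by omega)
    obtain ⟨k, hk, hσ⟩ := h ⟨(s % N).toNat, by omega⟩
    refine ⟨k, hk, ?_⟩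
    have h2 := hcyc ⟨(s % N).toNat, by omega⟩ k
    rw [hσ] at h2
    simp only [Int.toNat_of_nonneg h0] at h2
    rw [occ_congr (show (s + k) % N = (s % N + k) % N by simp), h2]
    simp
  · intro h i
    obtain ⟨k, hk, hσ⟩ := h i.1
    refine ⟨k, hk, ?_⟩
    rw [hcyc] at hσ
    simpa using hσ

lemma PerOK.update_false (h : PerOK N ℓ σ) (i : Fin N) :
    PerOK N ℓ (Function.update σ i false) := by
  rw [perOK_iff i.pos] at h ⊢
  intro s
  obtain ⟨k, hk, h'⟩ := h s
  exact ⟨k, hk, fun h'' => h' (occ_of_update_false h'')⟩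

/-- The `ℓ` sites following the site `s` are occupied. -/
def Block (ℓ : ℕ) (σ : Config N) (s : ℤ) : Prop :=
  ∀ u : ℕ, 1 ≤ u → u ≤ ℓ → occ σ (s + u)

lemma Block.not_occ (h : PerOK N ℓ σ) (hN : 0 < N) {s : ℤ} (hs : Block ℓ σ s) :
    ¬ occ σ s := by
  intro h0
  obtain ⟨k, hk, h'⟩ := (perOK_iff hN).mp h s
  rcases Nat.eq_zero_or_pos k with rfl | hpos
  · simp [h0] at h'
  · exact h' (hs k hpos hk)

lemma Block.not_occ_end (h : PerOK N ℓ σ) (hN : 0 < N) {s : ℤ} (hs : Block ℓ σ s) :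
    ¬ occ σ (s + ℓ + 1) := by
  intro h0
  obtain ⟨k, hk, h'⟩ := (perOK_iff hN).mp h (s + 1)
  rcases hk.lt_or_eq with hlt | rfl
  · apply h'
    have := hs (k + 1) (by omega) (by omega)
    rwa [show s + 1 + (k : ℤ) = s + ((k + 1 : ℕ) : ℤ) by push_cast; ring]
  · apply h'
    rwa [show s + 1 + (k : ℤ) = s + k + 1 by ring]

/-- The length of the run of occupied sites starting at site `1`, capped by `ℓ`. -/
def headRun (ℓ : ℕ) (σ : Config N) : ℕ :=
  Nat.findGreatest (fun b => ∀ u : ℕ, 1 ≤ u → u ≤ b → occ σ u) ℓ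

lemma headRun_le : headRun ℓ σ ≤ ℓ := Nat.findGreatest_le _

lemma occ_of_le_headRun {u : ℕ} (h1 : 1 ≤ u) (h2 : u ≤ headRun ℓ σ) : occ σ u :=
  Nat.findGreatest_spec (P := fun b => ∀ u : ℕ, 1 ≤ u → u ≤ b → occ σ u)
    (Nat.zero_le ℓ) (fun u h1 h2 => by omega) u h1 h2

lemma headRun_eq {b : ℕ} (hb : b ≤ ℓ) (h1 : ∀ u : ℕ, 1 ≤ u → u ≤ b → occ σ u)
    (h2 : ¬ occ σ (b + 1 : ℕ)) : headRun ℓ σ = b := by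
  refine Nat.findGreatest_eq_iff.mpr ⟨hb, fun _ => h1, fun c hc _ h => ?_⟩
  exact h2 (h (b + 1) (by omega) hc)

lemma not_occ_headRun_succ (h : PerOK N ℓ σ) (hN : 0 < N) :
    ¬ occ σ (headRun ℓ σ + 1 : ℕ) := by
  intro h0
  have hall : ∀ u : ℕ, 1 ≤ u → u ≤ headRun ℓ σ + 1 → occ σ u := by
    intro u h1 h2
    rcases h2.lt_or_eq with h3 | rfl
    · exact occ_of_le_headRun (ℓ := ℓ) h1 (by omega)
    · exact h0
  rcases (headRun_le (ℓ := ℓ) (σ := σ)).lt_or_eq with hlt | heq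
  · have := Nat.le_findGreatest (P := fun b => ∀ u : ℕ, 1 ≤ u → u ≤ b → occ σ u) hlt hall
    change headRun ℓ σ + 1 ≤ headRun ℓ σ at this
    omega
  · obtain ⟨k, hk, h'⟩ := (perOK_iff hN).mp h 1
    apply h'
    have := hall (k + 1) (by omega) (by omega)
    rwa [show (1 : ℤ) + k = ((k + 1 : ℕ) : ℤ) by push_cast; ring]

/-- The number of consecutive blocks, at most `n`, that start at the second site after the
initial run, with period `ℓ + 2`. -/
def blockCount (ℓ n : ℕ) (σ : Config N) : ℕ :=
  Nat.findGreatest (fun j => ∀ t < j, Block ℓ σ (headRun ℓ σ + 2 + t * (ℓ + 2) : ℕ)) n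

variable {n : ℕ}

lemma blockCount_le : blockCount ℓ n σ ≤ n := Nat.findGreatest_le _

lemma block_of_lt_blockCount {t : ℕ} (h : t < blockCount ℓ n σ) :
    Block ℓ σ (headRun ℓ σ + 2 + t * (ℓ + 2) : ℕ) :=
  Nat.findGreatest_spec
    (P := fun j => ∀ t < j, Block ℓ σ (headRun ℓ σ + 2 + t * (ℓ + 2) : ℕ))
    (Nat.zero_le n) (fun u h1 => by omega) t h

lemma not_block_blockCount (h : blockCount ℓ n σ < n) :
    ¬ Block ℓ σ (headRun ℓ σ + 2 + blockCount ℓ n σ * (ℓ + 2) : ℕ) := by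
  intro h0
  have := Nat.le_findGreatest
    (P := fun j => ∀ t < j, Block ℓ σ (headRun ℓ σ + 2 + t * (ℓ + 2) : ℕ)) h
    (fun t ht => by
      rcases (Nat.lt_succ_iff.mp ht).lt_or_eq with h1 | rfl
      · exact block_of_lt_blockCount h1
      · exact h0)
  change blockCount ℓ n σ + 1 ≤ blockCount ℓ n σ at this
  omega

lemma blockCount_eq {b j : ℕ} (hb : headRun ℓ σ = b) (hj : j ≤ n)
    (h1 : ∀ t < j, Block ℓ σ (b + 2 + t * (ℓ + 2) : ℕ))
    (h2 : j < n → ¬ Block ℓ σ (b + 2 + j * (ℓ + 2) : ℕ)) : blockCount ℓ n σ = j := by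
  subst hb
  refine Nat.findGreatest_eq_iff.mpr ⟨hj, fun _ => h1, fun c hc hcn h => ?_⟩
  exact h2 (by omega) (h j hc)

/-- The stage of a configuration in the matching: `0` if site `0` can be toggled, and otherwise
the lexicographic rank of the initial run and the number of blocks. -/
def stage (hN : 0 < N) (ℓ n : ℕ) (σ : Config N) : ℕ :=
  if PerOK N ℓ (Function.update σ ⟨0, hN⟩ true) then 0
  else 1 + (headRun ℓ σ * (n + 1) + blockCount ℓ n σ)

/-- The site toggled at stage `k`. -/
def stageSite (hN : 0 < N) (ℓ n k : ℕ) : Fin N :=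
  if k = 0 then ⟨0, hN⟩
  else ⟨((k - 1) / (n + 1) + 2 + (k - 1) % (n + 1) * (ℓ + 2)) % N, Nat.mod_lt _ hN⟩

/-- The stages at which all blocks are complete. -/
def critStage (n k : ℕ) : Prop := k ≠ 0 ∧ (k - 1) % (n + 1) = n

lemma critStage_stage (hN : 0 < N) : critStage n (stage hN ℓ n σ) ↔
    ¬ PerOK N ℓ (Function.update σ ⟨0, hN⟩ true) ∧ blockCount ℓ n σ = n := by
  unfold critStage stage
  split_ifs with h
  · simp [h]
  · have := blockCount_le (ℓ := ℓ) (n := n) (σ := σ)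
    rw [Nat.add_sub_cancel_left, Nat.mul_comm, Nat.mul_add_mod, Nat.mod_eq_of_lt (by omega)]
    simp [h]

lemma stage_mono (hN : 0 < N) (i : Fin N) :
    stage hN ℓ n (Function.update σ i false) ≤ stage hN ℓ n σ := by
  set τ := Function.update σ i false with hτ
  have hocc : ∀ t, occ τ t → occ σ t := fun t => occ_of_update_false
  unfold stage
  split_ifs with h1 h2 h2
  · exact le_rfl
  · exact Nat.zero_le _
  · exfalso
    apply h1
    rw [perOK_iff hN] at h2 ⊢
    intro s
    obtain ⟨k, hk, h'⟩ := h2 s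
    refine ⟨k, hk, fun h'' => h' ?_⟩
    rw [occ_update_true] at h'' ⊢
    exact h''.imp_left (hocc _)
  · have hrun : headRun ℓ τ ≤ headRun ℓ σ :=
      Nat.findGreatest_mono_left (fun b hb u h3 h4 => hocc _ (hb u h3 h4)) ℓ
    have hle := blockCount_le (ℓ := ℓ) (n := n) (σ := τ)
    rcases hrun.lt_or_eq with hlt | heq
    · have := Nat.mul_le_mul_right (n + 1) (Nat.succ_le_of_lt hlt)
      rw [Nat.succ_mul] at this
      omega
    · have : blockCount ℓ n τ ≤ blockCount ℓ n σ := by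
        unfold blockCount
        rw [heq]
        exact Nat.findGreatest_mono_left
          (fun j hj t ht u h3 h4 => hocc _ (hj t ht u h3 h4)) n
      rw [heq]
      omega

lemma not_occ_zero (hN : 0 < N) (h : PerOK N ℓ σ)
    (h0 : ¬ PerOK N ℓ (Function.update σ ⟨0, hN⟩ true)) : ¬ occ σ 0 := by
  intro h1
  apply h0
  have := (occ_coe (σ := σ) ⟨0, hN⟩).mp (by simpa using h1)
  rwa [← this, Function.update_eq_self]

/-- If site `0` cannot be filled, then filling it creates a run of `ℓ + 1` sites around it. -/
lemma exists_window (hN : 0 < N) (h : PerOK N ℓ σ)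
    (h0 : ¬ PerOK N ℓ (Function.update σ ⟨0, hN⟩ true)) :
    ∃ s : ℤ, s ≤ 0 ∧ 0 ≤ s + ℓ ∧
      ∀ k : ℕ, k ≤ ℓ → occ σ (s + k) ∨ (s + k) % N = 0 := by
  rw [perOK_iff hN] at h h0
  push Not at h0
  obtain ⟨s, hs⟩ := h0
  simp only [occ_update_true] at hs
  obtain ⟨k, hk, hσ⟩ := h s
  have hmod : (s + k) % N = 0 := by simpa using (hs k hk).resolve_left hσ
  obtain ⟨q, hq⟩ := Int.dvd_of_emod_eq_zero hmod
  refine ⟨-k, by omega, by omega, fun m hm => ?_⟩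
  have heq : (s : ℤ) + m = (-k + m) + N * q := by linarith
  have := hs m hm
  rw [heq, occ_add_mul, Int.add_mul_emod_self_left] at this
  simpa using this

lemma occ_neg (hN : ℓ + 1 < N) (h : PerOK N ℓ σ)
    (h0 : ¬ PerOK N ℓ (Function.update σ ⟨0, by omega⟩ true)) {x : ℕ} (h1 : 1 ≤ x)
    (h2 : x + headRun ℓ σ ≤ ℓ) : occ σ (-x) := by
  have hpos : 0 < N := by omega
  obtain ⟨s, hs0, hs1, hs⟩ := exists_window hpos h h0
  have hne : ∀ t : ℤ, t ≠ 0 → -N < t → t < N → t % N ≠ 0 := fun t h3 h4 h5 => by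
    simpa using emod_ne_of_near (i := ⟨0, hpos⟩) (t := t) (by simpa using h3)
      (by simpa using h4) (by simpa using h5)
  have hb : s + ℓ ≤ headRun ℓ σ := by
    by_contra! hlt
    have := hs ((headRun ℓ σ + 1 - s).toNat) (by omega)
    rw [show s + (((headRun ℓ σ : ℤ) + 1 - s).toNat : ℤ) = (headRun ℓ σ + 1 : ℕ) by omega]
      at this
    refine this.elim (not_occ_headRun_succ h hpos) (hne _ ?_ ?_ ?_) <;> omega
  have := hs (-x - s).toNat (by omega)
  rw [show s + (((-(x : ℤ)) - s).toNat : ℤ) = -x by omega] at this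
  exact this.resolve_right (hne _ (by omega) (by omega) (by omega))

end Occupation
section Toggle

variable {N ℓ n : ℕ} {σ : Config N}

lemma update_congr_window (hN : 0 < N) {τ : Config N} (h : ℓ + 1 < N) (hσ : PerOK N ℓ σ)
    (h0 : ¬ PerOK N ℓ (Function.update σ ⟨0, hN⟩ true))
    (hτ : ∀ t : ℤ, -N < t → t < N → t + ℓ ≥ headRun ℓ σ → t ≤ headRun ℓ σ →
      occ σ t → occ τ t) :
    ¬ PerOK N ℓ (Function.update τ ⟨0, hN⟩ true) := by
  rw [perOK_iff hN]
  push Not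
  have hle := headRun_le (ℓ := ℓ) (σ := σ)
  refine ⟨headRun ℓ σ - ℓ, fun k hk => ?_⟩
  rw [occ_update_true]
  rcases lt_trichotomy ((headRun ℓ σ : ℤ) - ℓ + k) 0 with hlt | heq | hgt
  · left
    have := occ_neg h hσ h0 (x := ℓ - headRun ℓ σ - k) (by omega) (by omega)
    rw [show -((ℓ - headRun ℓ σ - k : ℕ) : ℤ) = headRun ℓ σ - ℓ + k by omega] at this
    exact hτ _ (by omega) (by omega) (by omega) (by omega) this
  · right; simp [heq]
  · left
    have := occ_of_le_headRun (ℓ := ℓ) (σ := σ) (u := headRun ℓ σ + k - ℓ)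
      (by omega) (by omega)
    rw [show ((headRun ℓ σ + k - ℓ : ℕ) : ℤ) = headRun ℓ σ - ℓ + k by omega] at this
    exact hτ _ (by omega) (by omega) (by omega) (by omega) this

variable {p : ℕ}

lemma block_start_lt (hN : N = n * (ℓ + 2) + p + 1) (hb : headRun ℓ σ ≤ ℓ) {j : ℕ}
    (hj : j < n) : headRun ℓ σ + 2 + j * (ℓ + 2) + (ℓ - headRun ℓ σ) + p + 1 ≤ N := by
  have := Nat.mul_le_mul_right (ℓ + 2) (Nat.succ_le_of_lt hj)
  rw [Nat.succ_mul] at this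
  omega

/-- The first site of the first missing block can be filled. -/
lemma perOK_fill (hN : N = n * (ℓ + 2) + p + 1) (hσ : PerOK N ℓ σ)
    (hj : blockCount ℓ n σ < n) {i : Fin N}
    (hi : i.1 = headRun ℓ σ + 2 + blockCount ℓ n σ * (ℓ + 2)) :
    PerOK N ℓ (Function.update σ i true) := by
  have hpos : 0 < N := i.pos
  have hnl : ℓ + 2 ≤ n * (ℓ + 2) := Nat.le_mul_of_pos_left _ (by omega)
  by_contra hbad
  have hσ' := hσ
  rw [perOK_iff hpos] at hbad hσ'
  push Not at hbad
  obtain ⟨s, hs⟩ := hbad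
  obtain ⟨k, hk, hk'⟩ := hσ' s
  have hmod := (occ_update_true.mp (hs k hk)).resolve_left hk'
  have hprev : ¬ occ σ (i.1 - 1) := by
    rcases Nat.eq_zero_or_pos (blockCount ℓ n σ) with h0 | h0
    · have := not_occ_headRun_succ hσ hpos
      rwa [show (i.1 : ℤ) - 1 = (headRun ℓ σ + 1 : ℕ) by rw [hi, h0]; push_cast; ring]
    · have := (block_of_lt_blockCount (ℓ := ℓ) (n := n) (σ := σ)
        (t := blockCount ℓ n σ - 1) (by omega)).not_occ_end hσ hpos
      obtain ⟨c, hc⟩ : ∃ c, blockCount ℓ n σ = c + 1 := ⟨_, (Nat.sub_add_cancel h0).symm⟩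
      rw [hc, Nat.add_sub_cancel] at this
      rwa [show (i.1 : ℤ) - 1 = (headRun ℓ σ + 2 + c * (ℓ + 2) : ℕ) + ℓ + 1 by
        rw [hi, hc]; push_cast; ring]
  obtain ⟨q, hq⟩ : (N : ℤ) ∣ s + k - i.1 := hmod ▸ Int.dvd_self_sub_emod
  have hwin : ∀ m : ℕ, m ≤ ℓ → occ σ (i.1 - k + m) ∨ (i.1 - k + m : ℤ) % N = i.1 := by
    intro m hm
    have := hs m hm
    rwa [show s + (m : ℤ) = (i.1 - k + m) + N * q by linarith, occ_update_true,
      occ_add_mul, Int.add_mul_emod_self_left] at this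
  rcases Nat.eq_zero_or_pos k with rfl | hkpos
  · apply not_block_blockCount hj
    intro u h1 h2
    have := (hwin u h2).resolve_right
      (emod_ne_of_near (by push_cast; omega) (by push_cast; omega) (by push_cast; omega))
    rwa [Nat.cast_zero, sub_zero, hi] at this
  · have := hwin (k - 1) (by omega)
    rw [show (i.1 : ℤ) - k + ((k - 1 : ℕ) : ℤ) = i.1 - 1 by omega] at this
    exact this.elim hprev (emod_ne_of_near (by omega) (by omega) (by omega))

/-- Toggling the first site of the first missing block does not change the stage. -/
lemma stage_update (hpos : 0 < N) (hN : N = n * (ℓ + 2) + p + 1) (hσ : PerOK N ℓ σ)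
    (h0 : ¬ PerOK N ℓ (Function.update σ ⟨0, hpos⟩ true))
    (hj : blockCount ℓ n σ < n) {i : Fin N}
    (hi : i.1 = headRun ℓ σ + 2 + blockCount ℓ n σ * (ℓ + 2)) (x : Bool) :
    stage hpos ℓ n (Function.update σ i x) = stage hpos ℓ n σ := by
  have hnl : ℓ + 2 ≤ n * (ℓ + 2) := Nat.le_mul_of_pos_left _ (by omega)
  have hle := headRun_le (ℓ := ℓ) (σ := σ)
  have hlt := block_start_lt hN hle hj
  have hocc : ∀ t : ℤ, t ≠ i.1 → (i.1 : ℤ) - N < t → t < i.1 + N →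
      (occ (Function.update σ i x) t ↔ occ σ t) := fun t h1 h2 h3 =>
    occ_update_of_ne (emod_ne_of_near h1 h2 h3) x
  have hbad : ¬ PerOK N ℓ (Function.update (Function.update σ i x) ⟨0, hpos⟩ true) := by
    refine update_congr_window hpos (by omega) hσ h0 fun t h1 h2 h3 h4 h5 => ?_
    exact (hocc t (by omega) (by omega) (by omega)).mpr h5
  have hrun : headRun ℓ (Function.update σ i x) = headRun ℓ σ := by
    refine headRun_eq hle (fun u h1 h2 => ?_) ?_
    · rw [hocc _ (by omega) (by omega) (by omega)]
      exact occ_of_le_headRun h1 h2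
    · rw [hocc _ (by omega) (by omega) (by omega)]
      exact not_occ_headRun_succ hσ hpos
  have hblocks : blockCount ℓ n (Function.update σ i x) = blockCount ℓ n σ := by
    refine blockCount_eq hrun blockCount_le (fun t ht u h1 h2 => ?_) (fun h h' => ?_)
    · have := Nat.mul_le_mul_right (ℓ + 2) (Nat.succ_le_of_lt ht)
      rw [Nat.succ_mul] at this
      rw [hocc _ (by omega) (by omega) (by omega)]
      exact block_of_lt_blockCount ht u h1 h2
    · refine not_block_blockCount h fun u h1 h2 => ?_
      have := h' u h1 h2
      rwa [hocc _ (by omega) (by omega) (by omega)] at this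
  rw [stage, stage, if_neg hbad, if_neg h0, hrun, hblocks]

lemma stageSite_stage (hpos : 0 < N) (hN : N = n * (ℓ + 2) + p + 1)
    (h0 : ¬ PerOK N ℓ (Function.update σ ⟨0, hpos⟩ true)) (hj : blockCount ℓ n σ < n) :
    (stageSite hpos ℓ n (stage hpos ℓ n σ)).1 =
      headRun ℓ σ + 2 + blockCount ℓ n σ * (ℓ + 2) := by
  have hlt := block_start_lt hN (headRun_le (ℓ := ℓ) (σ := σ)) hj
  rw [stageSite, stage, if_neg h0, if_neg (by omega)]
  simp only [Nat.add_sub_cancel_left]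
  rw [mul_comm (headRun ℓ σ), Nat.mul_add_div (by omega), Nat.mul_add_mod,
    Nat.mod_eq_of_lt (by omega : blockCount ℓ n σ < n + 1), Nat.div_eq_of_lt (by omega),
    add_zero, Nat.mod_eq_of_lt (by omega)]

lemma perOK_update_stageSite (hpos : 0 < N) (hN : N = n * (ℓ + 2) + p + 1)
    (hσ : PerOK N ℓ σ) (hc : ¬ critStage n (stage hpos ℓ n σ)) :
    PerOK N ℓ (Function.update σ (stageSite hpos ℓ n (stage hpos ℓ n σ)) true) := by
  by_cases h0 : PerOK N ℓ (Function.update σ ⟨0, hpos⟩ true)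
  · rwa [stage, if_pos h0, stageSite, if_pos rfl]
  · rw [critStage_stage, not_and] at hc
    have hj := lt_of_le_of_ne blockCount_le (hc h0)
    exact perOK_fill hN hσ hj (stageSite_stage hpos hN h0 hj)

lemma stage_update_stageSite (hpos : 0 < N) (hN : N = n * (ℓ + 2) + p + 1)
    (hσ : PerOK N ℓ σ) (hc : ¬ critStage n (stage hpos ℓ n σ)) (x : Bool) :
    stage hpos ℓ n (Function.update σ (stageSite hpos ℓ n (stage hpos ℓ n σ)) x) =
      stage hpos ℓ n σ := by
  by_cases h0 : PerOK N ℓ (Function.update σ ⟨0, hpos⟩ true)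
  · have hs : stage hpos ℓ n σ = 0 := by rw [stage, if_pos h0]
    rw [hs, stageSite, if_pos rfl, stage, if_pos]
    rwa [Function.update_idem]
  · rw [critStage_stage, not_and] at hc
    have hj := lt_of_le_of_ne blockCount_le (hc h0)
    exact stage_update hpos hN hσ h0 hj (stageSite_stage hpos hN h0 hj) x

end Toggle
section Critical

/-- The pattern `0 1^b 0 (0 1^ℓ 0)^n 1 1 1 …`. -/
def critPattern (ℓ n b t : ℕ) : Prop :=
  t ≠ 0 ∧ (b + 2 + n * (ℓ + 2) ≤ t ∨ 2 ≤ (t + (ℓ - b) + 1) % (ℓ + 2))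

/-- The critical configuration with initial run of length `b`. -/
def critConfig (N ℓ n b : ℕ) : Config N := fun t => decide (critPattern ℓ n b t)

variable {N ℓ n p b : ℕ}

lemma not_critPattern_zero : ¬ critPattern ℓ n b 0 := fun h => h.1 rfl

lemma critPattern_run (hb : b ≤ ℓ) {t : ℕ} (h1 : 1 ≤ t) (h2 : t ≤ b) :
    critPattern ℓ n b t :=
  ⟨by omega, Or.inr (by rw [Nat.mod_eq_of_lt (by omega)]; omega)⟩

lemma not_critPattern_run_succ (hb : b ≤ ℓ) : ¬ critPattern ℓ n b (b + 1) := by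
  rintro ⟨-, h | h⟩
  · omega
  · rw [show b + 1 + (ℓ - b) + 1 = ℓ + 2 by omega, Nat.mod_self] at h
    omega

lemma critPattern_block (hb : b ≤ ℓ) {q u : ℕ} (hq : q < n) (hu : u < ℓ + 2) :
    critPattern ℓ n b (b + 2 + q * (ℓ + 2) + u) ↔ 1 ≤ u ∧ u ≤ ℓ := by
  have h1 := Nat.mul_le_mul_right (ℓ + 2) (Nat.succ_le_of_lt hq)
  rw [Nat.succ_mul] at h1
  have h2 : b + 2 + q * (ℓ + 2) + u + (ℓ - b) + 1 = (ℓ + 2) * (q + 1) + (u + 1) := by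
    have : (ℓ + 2) * (q + 1) = q * (ℓ + 2) + (ℓ + 2) := by ring
    omega
  unfold critPattern
  rw [h2, Nat.mul_add_mod]
  rcases (by omega : u + 1 < ℓ + 2 ∨ u = ℓ + 1) with h | h
  · rw [Nat.mod_eq_of_lt h]; omega
  · subst h; rw [Nat.mod_self]; omega

lemma critPattern_tail {t : ℕ} (h : b + 2 + n * (ℓ + 2) ≤ t) : critPattern ℓ n b t :=
  ⟨by omega, Or.inl h⟩

lemma exists_block_coord {t : ℕ} (h1 : b + 2 ≤ t) (h2 : t < b + 2 + n * (ℓ + 2)) :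
    ∃ q < n, ∃ u < ℓ + 2, t = b + 2 + q * (ℓ + 2) + u := by
  refine ⟨(t - b - 2) / (ℓ + 2), (Nat.div_lt_iff_lt_mul (by omega)).mpr (by omega),
    (t - b - 2) % (ℓ + 2), Nat.mod_lt _ (by omega), ?_⟩
  have := Nat.div_add_mod (t - b - 2) (ℓ + 2)
  rw [mul_comm] at this
  omega

/-- Before the tail, every `ℓ + 1` consecutive sites of the pattern contain an empty site. -/
lemma exists_not_critPattern (hb : b ≤ ℓ) {t : ℕ} (ht : t < b + 2 + n * (ℓ + 2)) :
    ∃ k ≤ ℓ, ¬ critPattern ℓ n b (t + k) := by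
  by_cases hm : 2 ≤ (t + (ℓ - b) + 1) % (ℓ + 2)
  swap
  · refine ⟨0, Nat.zero_le _, ?_⟩
    rintro ⟨-, h | h⟩
    · omega
    · exact hm h
  have hdiv := Nat.div_add_mod (t + (ℓ - b) + 1) (ℓ + 2)
  have hlt := Nat.mod_lt (t + (ℓ - b) + 1) (show 0 < ℓ + 2 by omega)
  set m := (t + (ℓ - b) + 1) % (ℓ + 2)
  set q := (t + (ℓ - b) + 1) / (ℓ + 2)
  have hq : q < n + 1 := by
    by_contra! h
    have := Nat.mul_le_mul_left (ℓ + 2) h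
    have h' : (ℓ + 2) * (n + 1) = n * (ℓ + 2) + (ℓ + 2) := by ring
    omega
  have hq' := Nat.mul_le_mul_left (ℓ + 2) (Nat.succ_le_of_lt hq)
  have h1 : (ℓ + 2) * (n + 1) = n * (ℓ + 2) + (ℓ + 2) := by ring
  have h2 : (ℓ + 2) * (q + 1) = (ℓ + 2) * q + (ℓ + 2) := by ring
  rw [Nat.succ_eq_add_one] at hq'
  refine ⟨ℓ + 2 - m, by omega, ?_⟩
  rintro ⟨-, h | h⟩
  · omega
  · rw [show t + (ℓ + 2 - m) + (ℓ - b) + 1 = (ℓ + 2) * (q + 1) by omega,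
      Nat.mul_mod_right] at h
    omega

lemma occ_critConfig {t : ℕ} (ht : t < N) :
    occ (critConfig N ℓ n b) t ↔ critPattern ℓ n b t := by
  rw [occ_coe (σ := critConfig N ℓ n b) ⟨t, ht⟩]
  simp [critConfig]

/-- The lengths of the initial runs of critical configurations. -/
def critRuns (ℓ p : ℕ) : Finset ℕ := (Finset.range (ℓ + 1)).filter fun b => p ≤ ℓ → b = p

lemma mem_critRuns : b ∈ critRuns ℓ p ↔ b ≤ ℓ ∧ (p ≤ ℓ → b = p) := by
  simp [critRuns]

variable (hN : N = n * (ℓ + 2) + p + 1) (hp : p ≤ ℓ + 1) (hb : b ∈ critRuns ℓ p)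

include hN hp hb

lemma size_cases : (p = b ∧ b ≤ ℓ ∧ N + 1 = b + 2 + n * (ℓ + 2)) ∨
    (p = ℓ + 1 ∧ b ≤ ℓ ∧ N = b + 2 + n * (ℓ + 2) + (ℓ - b)) := by
  obtain ⟨h1, h2⟩ := mem_critRuns.mp hb
  rcases hp.lt_or_eq with h | h
  · have := h2 (by omega); omega
  · omega

lemma perOK_critConfig : PerOK N ℓ (critConfig N ℓ n b) := by
  have hc := size_cases hN hp hb
  intro i
  by_cases hi : N ≤ i.1 + ℓ
  · refine ⟨N - i.1, by omega, ?_⟩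
    have : cyc i (N - i.1) = ⟨0, i.pos⟩ := by
      ext
      simp only [cyc]
      rw [Nat.add_sub_cancel' i.2.le, Nat.mod_self]
    rw [this]
    simp [critConfig, not_critPattern_zero]
  · obtain ⟨k, hk, h⟩ := exists_not_critPattern (n := n) (t := i.1)
      (mem_critRuns.mp hb).1 (by omega)
    refine ⟨k, hk, ?_⟩
    have : (i.1 + k) % N = i.1 + k := Nat.mod_eq_of_lt (by omega)
    simp [critConfig, cyc, this, h]

lemma not_perOK_fill_critConfig (hpos : 0 < N) :
    ¬ PerOK N ℓ (Function.update (critConfig N ℓ n b) ⟨0, hpos⟩ true) := by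
  have hc := size_cases hN hp hb
  have hbl := (mem_critRuns.mp hb).1
  rw [perOK_iff hpos]
  push Not
  refine ⟨b - ℓ, fun k hk => ?_⟩
  rw [occ_update_true]
  by_cases hsmall : N = b + 1
  · have hnn := Int.emod_nonneg ((b : ℤ) - ℓ + k) (b := N) (by omega)
    have hlt := Int.emod_lt_of_pos ((b : ℤ) - ℓ + k) (b := N) (by omega)
    rcases hnn.eq_or_lt with h | h
    · exact Or.inr h.symm
    · left
      obtain ⟨t, ht⟩ := Int.eq_ofNat_of_zero_le hnn
      rw [occ_congr (Int.emod_emod_of_dvd _ dvd_rfl).symm, ht, occ_critConfig (by omega)]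
      exact critPattern_run hbl (by omega) (by omega)
  have hlarge : ℓ + 1 < N := by
    rcases Nat.eq_zero_or_pos n with rfl | hn
    · omega
    · have := Nat.le_mul_of_pos_left (ℓ + 2) hn
      omega
  rcases lt_trichotomy ((b : ℤ) - ℓ + k) 0 with hlt | heq | hgt
  · left
    rw [← occ_add_period, show (b : ℤ) - ℓ + k + N = (N + b + k - ℓ : ℕ) by omega,
      occ_critConfig (by omega)]
    rcases hc with hc | hc
    · obtain ⟨m, rfl⟩ : ∃ m, n = m + 1 := by
        rcases Nat.eq_zero_or_pos n with rfl | hn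
        · omega
        · exact ⟨_, (Nat.sub_add_cancel hn).symm⟩
      rw [Nat.succ_mul] at hc
      rw [show N + b + k - ℓ = b + 2 + m * (ℓ + 2) + (b + k + 1) by omega,
        critPattern_block hbl (by omega) (by omega)]
      omega
    · exact critPattern_tail (by omega)
  · right; simp [heq]
  · left
    rw [show (b : ℤ) - ℓ + k = (b + k - ℓ : ℕ) by omega, occ_critConfig (by omega)]
    exact critPattern_run hbl (by omega) (by omega)

lemma headRun_critConfig : headRun ℓ (critConfig N ℓ n b) = b := by
  have hc := size_cases hN hp hb
  have hbl := (mem_critRuns.mp hb).1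
  refine headRun_eq hbl (fun u h1 h2 => ?_) ?_
  · rw [occ_critConfig (by omega)]
    exact critPattern_run hbl h1 h2
  · rcases (by omega : b + 1 < N ∨ b + 1 = N) with h | h
    · rw [occ_critConfig h]
      exact not_critPattern_run_succ hbl
    · rw [h, ← zero_add ((N : ℕ) : ℤ), occ_add_period, ← Nat.cast_zero,
        occ_critConfig (by omega)]
      exact not_critPattern_zero

lemma blockCount_critConfig : blockCount ℓ n (critConfig N ℓ n b) = n := by
  have hc := size_cases hN hp hb
  have hbl := (mem_critRuns.mp hb).1
  refine blockCount_eq (headRun_critConfig hN hp hb) le_rfl (fun t ht u h1 h2 => ?_)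
    fun h => absurd h (lt_irrefl n)
  have := Nat.mul_le_mul_right (ℓ + 2) (Nat.succ_le_of_lt ht)
  rw [Nat.succ_mul] at this
  rw [← Nat.cast_add, occ_critConfig (by omega), critPattern_block hbl ht (by omega)]
  exact ⟨h1, h2⟩

omit hb in
/-- The critical configurations are determined by their initial run. -/
lemma eq_critConfig (hpos : 0 < N) {σ : Config N} (hσ : PerOK N ℓ σ)
    (h0 : ¬ PerOK N ℓ (Function.update σ ⟨0, hpos⟩ true)) (hj : blockCount ℓ n σ = n) :
    headRun ℓ σ ∈ critRuns ℓ p ∧ σ = critConfig N ℓ n (headRun ℓ σ) := by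
  have hz := not_occ_zero hpos hσ h0
  by_cases hlarge : ℓ + 1 < N
  · have hle := headRun_le (ℓ := ℓ) (σ := σ)
    have hblock : ∀ t < n, Block ℓ σ (headRun ℓ σ + 2 + t * (ℓ + 2) : ℕ) := fun t ht =>
      block_of_lt_blockCount (hj.symm ▸ ht)
    have hneg : ∀ x : ℕ, 1 ≤ x → x + headRun ℓ σ ≤ ℓ → occ σ (-x) := fun x h1 h2 =>
      occ_neg hlarge hσ h0 h1 h2
    have hsucc := not_occ_headRun_succ hσ hpos
    have hrun : ∀ u : ℕ, 1 ≤ u → u ≤ headRun ℓ σ → occ σ u := fun u h1 h2 =>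
      occ_of_le_headRun h1 h2
    set b := headRun ℓ σ
    have hb : b ∈ critRuns ℓ p := by
      refine mem_critRuns.mpr ⟨hle, fun hpl => ?_⟩
      obtain ⟨m, rfl⟩ : ∃ m, n = m + 1 := by
        rcases Nat.eq_zero_or_pos n with rfl | hn
        · omega
        · exact ⟨_, (Nat.sub_add_cancel hn).symm⟩
      rw [Nat.succ_mul] at hN
      have hbm := hblock m (by omega)
      have hend := hbm.not_occ_end hσ hpos
      rcases lt_trichotomy b p with h | h | h
      · exfalso
        apply hend
        have := hneg (p - b) (by omega) (by omega)
        rw [← occ_add_period] at this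
        rwa [show -((p - b : ℕ) : ℤ) + N = (b + 2 + m * (ℓ + 2) : ℕ) + ℓ + 1 by omega]
          at this
      · exact h
      · exfalso
        apply hz
        have := hbm (ℓ + 1 + p - b) (by omega) (by omega)
        rwa [show ((b + 2 + m * (ℓ + 2) : ℕ) : ℤ) + (ℓ + 1 + p - b : ℕ) = 0 + N by omega,
          occ_add_period] at this
    refine ⟨hb, ext_occ fun t ht => ?_⟩
    rw [occ_critConfig ht]
    have hc := size_cases hN hp hb
    rcases Nat.eq_zero_or_pos t with rfl | htpos
    · exact iff_of_false (by simpa using hz) not_critPattern_zero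
    rcases (by omega : t ≤ b ∨ t = b + 1 ∨ b + 2 ≤ t) with h | rfl | h
    · exact iff_of_true (hrun t htpos h) (critPattern_run hle htpos h)
    · exact iff_of_false hsucc (not_critPattern_run_succ hle)
    rcases lt_or_ge t (b + 2 + n * (ℓ + 2)) with h1 | h1
    · obtain ⟨q, hq, u, hu, rfl⟩ := exists_block_coord h h1
      rw [critPattern_block hle hq hu]
      rcases (by omega : u = 0 ∨ u = ℓ + 1 ∨ (1 ≤ u ∧ u ≤ ℓ)) with rfl | rfl | h2
      · exact iff_of_false ((hblock q hq).not_occ hσ hpos) (by omega)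
      · refine iff_of_false ?_ (by omega)
        have := (hblock q hq).not_occ_end hσ hpos
        rwa [add_assoc, ← Nat.cast_succ, ← Nat.cast_add] at this
      · refine iff_of_true ?_ h2
        have := hblock q hq u h2.1 h2.2
        rwa [← Nat.cast_add] at this
    · refine iff_of_true ?_ (critPattern_tail h1)
      have := hneg (N - t) (by omega) (by omega)
      rw [← occ_add_period] at this
      rwa [show -((N - t : ℕ) : ℤ) + N = t by omega] at this
  · have hn : n = 0 := by
      by_contra hn
      have : ℓ + 2 ≤ n * (ℓ + 2) := Nat.le_mul_of_pos_left _ (by omega)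
      omega
    subst hn
    have hall : ∀ t : ℕ, 1 ≤ t → t ≤ p → occ σ t := by
      intro t h1 h2
      obtain ⟨s, -, -, hs⟩ := exists_window hpos hσ h0
      have hnn := Int.emod_nonneg ((t : ℤ) - s) (b := N) (by omega)
      have hlt := Int.emod_lt_of_pos ((t : ℤ) - s) (b := N) (by omega)
      have := hs (((t : ℤ) - s) % N).toNat (by omega)
      rw [Int.toNat_of_nonneg hnn] at this
      have hmod : (s + ((t : ℤ) - s) % N) % N = (t : ℤ) % N := by simp
      rw [hmod, occ_congr hmod] at this
      refine this.resolve_right ?_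
      rw [Int.emod_eq_of_lt (by omega) (by omega)]
      omega
    have hrun : headRun ℓ σ = p := by
      refine headRun_eq (by omega) hall ?_
      rw [show ((p + 1 : ℕ) : ℤ) = 0 + N by omega, occ_add_period]
      exact hz
    rw [hrun]
    refine ⟨mem_critRuns.mpr ⟨by omega, fun _ => rfl⟩, ext_occ fun t ht => ?_⟩
    rw [occ_critConfig ht]
    rcases Nat.eq_zero_or_pos t with rfl | htpos
    · exact iff_of_false (by simpa using hz) not_critPattern_zero
    · exact iff_of_true (hall t htpos (by omega))
        (critPattern_run (by omega) htpos (by omega))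

end Critical

lemma sum_blocks {ℓ c : ℕ} {g : ℕ → ℕ} : ∀ n : ℕ,
    (∀ q < n, ∀ u < ℓ + 2, g (c + q * (ℓ + 2) + u) = if 1 ≤ u ∧ u ≤ ℓ then 1 else 0) →
    ∑ t ∈ Finset.range (n * (ℓ + 2)), g (c + t) = n * ℓ
  | 0, _ => by simp
  | n + 1, h => by
    have hlast : ∑ u ∈ Finset.range (ℓ + 2), g (c + (n * (ℓ + 2) + u)) = ℓ := by
      rw [Finset.sum_congr rfl fun u hu => by
        rw [← add_assoc, h n (by omega) u (Finset.mem_range.mp hu)], ← Finset.card_filter]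
      rw [show ((Finset.range (ℓ + 2)).filter fun u => 1 ≤ u ∧ u ≤ ℓ) = Finset.Icc 1 ℓ by
        ext u; simp; omega]
      simp
    rw [Nat.succ_mul, Finset.sum_range_add, hlast,
      sum_blocks n fun q hq u hu => h q (by omega) u hu, Nat.succ_mul]

lemma fermions_eq_sum {N : ℕ} (P : ℕ → Prop) :
    fermions (fun t : Fin N => decide (P t)) =
      ∑ t ∈ Finset.range N, if P t then 1 else 0 := by
  rw [fermions, Finset.card_filter, Finset.sum_range]
  simp

lemma sum_critPattern {ℓ n b : ℕ} (hb : b ≤ ℓ) :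
    ∑ t ∈ Finset.range (b + 2 + n * (ℓ + 2)), (if critPattern ℓ n b t then 1 else 0) =
      b + n * ℓ := by
  rw [Finset.sum_range_add]
  congr 1
  · rw [Finset.sum_range_succ, Finset.sum_range_succ', if_neg not_critPattern_zero,
      if_neg (not_critPattern_run_succ hb), Finset.sum_congr rfl fun t ht =>
        if_pos (critPattern_run hb (by omega) (Finset.mem_range.mp ht))]
    simp
  · exact sum_blocks (g := fun t => if critPattern ℓ n b t then 1 else 0) n
      fun q hq u hu => by simp only [critPattern_block hb hq hu]

lemma fermions_critConfig {N ℓ n p b : ℕ} (hN : N = n * (ℓ + 2) + p + 1) (hp : p ≤ ℓ + 1)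
    (hb : b ∈ critRuns ℓ p) : fermions (critConfig N ℓ n b) = n * ℓ + min p ℓ := by
  have hbl := (mem_critRuns.mp hb).1
  have hsum := sum_critPattern (n := n) hbl
  unfold critConfig
  rw [fermions_eq_sum]
  rcases size_cases hN hp hb with ⟨h1, -, h2⟩ | ⟨h1, -, h2⟩
  · have hlast : ¬ critPattern ℓ n b N := by
      rintro ⟨-, h | h⟩
      · omega
      · have h3 : N + (ℓ - b) + 1 = (ℓ + 2) * (n + 1) := by
          rw [mul_comm, Nat.succ_mul]
          omega
        rw [h3, Nat.mul_mod_right] at h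
        omega
    rw [← h2, Finset.sum_range_succ, if_neg hlast] at hsum
    omega
  · rw [h2, Finset.sum_range_add, hsum, Finset.sum_congr rfl fun t _ =>
      if_pos (critPattern_tail (by omega))]
    simp
    omega

lemma card_critRuns {ℓ p : ℕ} : (critRuns ℓ p).card = if p ≤ ℓ then 1 else ℓ + 1 := by
  unfold critRuns
  split_ifs with h
  · rw [Finset.card_eq_one]
    refine ⟨p, ?_⟩
    ext b
    simp [h]
  · simp [h]

lemma perOK_critStage_iff {N ℓ n p : ℕ} (hN : N = n * (ℓ + 2) + p + 1) (hp : p ≤ ℓ + 1)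
    (hpos : 0 < N) (σ : Config N) : PerOK N ℓ σ ∧ critStage n (stage hpos ℓ n σ) ↔
      ∃ b ∈ critRuns ℓ p, critConfig N ℓ n b = σ := by
  rw [critStage_stage]
  constructor
  · rintro ⟨h1, h2, h3⟩
    obtain ⟨h4, h5⟩ := eq_critConfig hN hp hpos h1 h2 h3
    exact ⟨_, h4, h5.symm⟩
  · rintro ⟨b, hb, rfl⟩
    exact ⟨perOK_critConfig hN hp hb, not_perOK_fill_critConfig hN hp hb hpos,
      blockCount_critConfig hN hp hb⟩

lemma card_critical {N ℓ n p : ℕ} (hN : N = n * (ℓ + 2) + p + 1) (hp : p ≤ ℓ + 1)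
    (hpos : 0 < N) : Nat.card {σ : Config N // PerOK N ℓ σ ∧ critStage n (stage hpos ℓ n σ)} =
      if p ≤ ℓ then 1 else ℓ + 1 := by
  have himage : {σ : Config N | PerOK N ℓ σ ∧ critStage n (stage hpos ℓ n σ)} =
      critConfig N ℓ n '' critRuns ℓ p :=
    Set.ext (perOK_critStage_iff hN hp hpos)
  have hinj : Set.InjOn (critConfig N ℓ n) (critRuns ℓ p) := fun b hb c hc h => by
    rw [← headRun_critConfig hN hp hb, h, headRun_critConfig hN hp hc]
  rw [← card_critRuns, ← Set.ncard_coe_finset, ← hinj.ncard_image, ← himage]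
  rfl

/-- The matching of the configurations of the closed chain. -/
lemma stagedMatching_closed {N ℓ n p : ℕ} (hN : N = n * (ℓ + 2) + p + 1) (hp : p ≤ ℓ + 1)
    (hpos : 0 < N) : StagedMatching (PerOK N ℓ) (stage hpos ℓ n) (stageSite hpos ℓ n)
      (critStage n) (n * ℓ + min p ℓ) where
  down _ i h := h.update_false i
  mono _ i _ := stage_mono hpos i
  toggle_ok _ h hc := perOK_update_stageSite hpos hN h hc
  toggle_stage _ x h hc := stage_update_stageSite hpos hN h hc x
  fermions_crit σ h hc := by
    obtain ⟨b, hb, rfl⟩ := (perOK_critStage_iff hN hp hpos σ).mp ⟨h, hc⟩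
    exact fermions_critConfig hN hp hb

/-- Ground states of the closed chain: for the `M_ℓ` model with periodic boundary
conditions on `N = n(ℓ+2)+p+1` sites, `0 ≤ p ≤ ℓ+1`, the cohomology (equivalently,
the space of zero-energy ground states) is one-dimensional, concentrated at fermion
number `f = nℓ+p`, when `0 ≤ p ≤ ℓ`, and is `(ℓ+1)`-dimensional, concentrated at
fermion number `f = (n+1)ℓ`, when `p = ℓ+1`. -/
theorem ground_states_closed_chain (ℓ n p N : ℕ) (hℓ : 1 ≤ ℓ) (hp : p ≤ ℓ + 1)
    (hN : N = n * (ℓ + 2) + p + 1) :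
    (p ≤ ℓ → ∀ f, cohDim N (PerOK N ℓ) (fun _ => True) f =
      if f = n * ℓ + p then 1 else 0) ∧
    (p = ℓ + 1 → ∀ f, cohDim N (PerOK N ℓ) (fun _ => True) f =
      if f = (n + 1) * ℓ then ℓ + 1 else 0) := by
  have h := (stagedMatching_closed hN hp (by omega)).cohDim_eq
  simp only [card_critical hN hp] at h
  constructor
  · intro hpl f
    rw [h, min_eq_left hpl, if_pos hpl]
  · rintro rfl f
    rw [h, min_eq_right (Nat.le_succ ℓ), Nat.succ_mul,
      if_neg (show ¬ ℓ + 1 ≤ ℓ by omega)]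

end
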